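/- Let T be a light tournament with weight function w : V(T) → ℚ>0 in which every vertex lies in a directed triangle, and suppose some x attaining the minimum of Σ_v w(v)x_v over the basic relaxation P(T) satisfies x_v < 1/2 for every vertex v. Then T has a feedback vertex set F' with w(F') ≤ (9/4)·SA₀(T,w). -/

import Mathlib

variable {V : Type*}

/-- A directed triangle: arcs `a → b`, `b → c`, `c → a`. -/
def Triangle (arc : V → V → Prop) (a b c : V) : Prop :=
  arc a b ∧ arc b c ∧ arc c a

/-- A tournament: an irreflexive relation with exactly one arc between any two
distinct vertices. -/
def IsTournament (arc : V → V → Prop) : Prop :=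
  (∀ v, ¬ arc v v) ∧ ∀ a b : V, a ≠ b → (arc a b ↔ ¬ arc b a)

/-- A feedback vertex set: removing `X` leaves no directed triangle. -/
def IsFVS (arc : V → V → Prop) (X : Set V) : Prop :=
  ∀ a b c : V, a ∉ X → b ∉ X → c ∉ X → ¬ Triangle arc a b c

/-- The pair `{a,b}` is a diagonal: there are `u, v` such that both `{u,v,a}` and
`{u,v,b}` are triangles. -/
def IsDiagonal (arc : V → V → Prop) (a b : V) : Prop :=
  ∃ u v : V, Triangle arc u v a ∧ Triangle arc u v b

/-- A heavy triangle: a triangle at least two of whose vertex pairs are diagonals. -/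
def HeavyTriangle (arc : V → V → Prop) (a b c : V) : Prop :=
  Triangle arc a b c ∧
  ((IsDiagonal arc a b ∧ IsDiagonal arc b c) ∨
   (IsDiagonal arc a b ∧ IsDiagonal arc a c) ∨
   (IsDiagonal arc b c ∧ IsDiagonal arc a c))

/-- A tournament is heavy if it contains a heavy triangle. -/
def IsHeavy (arc : V → V → Prop) : Prop := ∃ a b c : V, HeavyTriangle arc a b c

/-- A tournament is light if it is not heavy. -/
def IsLight (arc : V → V → Prop) : Prop := ¬ IsHeavy arc

/-- The basic LP relaxation `P(T)`: `x ∈ [0,1]^V` with `x_a + x_b + x_c ≥ 1`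
for every triangle. -/
def BasicFeasible (arc : V → V → Prop) (x : V → ℝ) : Prop :=
  (∀ v, 0 ≤ x v ∧ x v ≤ 1) ∧
  ∀ a b c, Triangle arc a b c → 1 ≤ x a + x b + x c

/-- `SA₀(T,w)`: the optimum value of the basic relaxation. -/
noncomputable def SA0Val [Fintype V] (arc : V → V → Prop) (w : V → ℚ) : ℝ :=
  sInf {t : ℝ | ∃ x, BasicFeasible arc x ∧ t = ∑ v, (w v : ℝ) * x v}

namespace IsTournament

variable {arc : V → V → Prop}

theorem not_arc (hT : IsTournament arc) {a b : V} (h : arc a b) : ¬ arc b a := by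
  rcases eq_or_ne a b with rfl | hab
  · exact hT.1 a
  · exact (hT.2 a b hab).1 h

theorem arc_of_not_arc (hT : IsTournament arc) {a b : V} (hab : a ≠ b) (h : ¬ arc a b) :
    arc b a :=
  (hT.2 b a hab.symm).2 h

theorem flip (hT : IsTournament arc) : IsTournament (flip arc) :=
  ⟨hT.1, fun a b hab => hT.2 b a hab.symm⟩

theorem comap {W : Type*} (hT : IsTournament arc) {f : W → V} (hf : f.Injective) :
    IsTournament (fun a b => arc (f a) (f b)) :=
  ⟨fun v => hT.1 (f v), fun a b hab => hT.2 (f a) (f b) (hf.ne hab)⟩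

end IsTournament

namespace IsLight

variable {arc : V → V → Prop}

theorem comap {W : Type*} (hl : IsLight arc) (f : W → V) :
    IsLight (fun a b => arc (f a) (f b)) := by
  have hd : ∀ {a b}, IsDiagonal (fun a b => arc (f a) (f b)) a b → IsDiagonal arc (f a) (f b) :=
    fun ⟨u, v, h⟩ => ⟨f u, f v, h⟩
  rintro ⟨a, b, c, ht, h⟩
  exact hl ⟨f a, f b, f c, ht, h.imp (.imp hd hd) (.imp (.imp hd hd) (.imp hd hd))⟩

theorem flip (hl : IsLight arc) : IsLight (flip arc) := by
  have hd : ∀ {a b}, IsDiagonal (_root_.flip arc) a b → IsDiagonal arc b a :=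
    fun ⟨u, v, ⟨h₁, h₂, h₃⟩, ⟨_, h₄, h₅⟩⟩ => ⟨v, u, ⟨h₁, h₅, h₄⟩, ⟨h₁, h₃, h₂⟩⟩
  rintro ⟨a, b, c, ⟨hab, hbc, hca⟩, h⟩
  refine hl ⟨c, b, a, ⟨hbc, hab, hca⟩, ?_⟩
  rcases h with h | h | h
  · exact .inl ⟨hd h.2, hd h.1⟩
  · exact .inr (.inr ⟨hd h.1, hd h.2⟩)
  · exact .inr (.inl ⟨hd h.1, hd h.2⟩)

theorem not_two_diagonals (hl : IsLight arc) {a b c : V} (ht : Triangle arc a b c)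
    (hab : IsDiagonal arc a b) (hbc : IsDiagonal arc b c) : False :=
  hl ⟨a, b, c, ht, .inl ⟨hab, hbc⟩⟩

/-- The triangles through a fixed arc have a triangle-free set of apices. -/
theorem not_triangle_of_arc (hl : IsLight arc) {u v a b c : V} (huv : arc u v)
    (hva : arc v a) (hvb : arc v b) (hvc : arc v c) (hau : arc a u) (hbu : arc b u)
    (hcu : arc c u) : ¬ Triangle arc a b c := fun ht =>
  hl.not_two_diagonals ht ⟨u, v, ⟨huv, hva, hau⟩, ⟨huv, hvb, hbu⟩⟩
    ⟨u, v, ⟨huv, hvb, hbu⟩, ⟨huv, hvc, hcu⟩⟩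

theorem not_triangle_of_common_out (hT : IsTournament arc) (hl : IsLight arc)
    {z a b y₀ y₁ y₂ : V} (h₀ : arc z y₀) (h₁ : arc z y₁) (h₂ : arc z y₂) (h₀a : arc y₀ a)
    (h₁a : arc y₁ a) (h₂b : arc y₂ b) (haz : arc a z) (hbz : arc b z) :
    ¬ Triangle arc y₀ y₁ y₂ := by
  rintro ⟨h₀₁, h₁₂, h₂₀⟩
  by_cases h₂a : arc y₂ a
  · exact hl.not_triangle_of_arc haz h₀ h₁ h₂ h₀a h₁a h₂a ⟨h₀₁, h₁₂, h₂₀⟩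
  have ha₂ : arc a y₂ := hT.arc_of_not_arc (by rintro rfl; exact hT.not_arc haz h₂) h₂a
  by_cases h₁b : arc y₁ b
  · exact hl.not_two_diagonals ⟨h₀₁, h₁₂, h₂₀⟩ ⟨a, z, ⟨haz, h₀, h₀a⟩, ⟨haz, h₁, h₁a⟩⟩
      ⟨b, z, ⟨hbz, h₁, h₁b⟩, ⟨hbz, h₂, h₂b⟩⟩
  have hb₁ : arc b y₁ := hT.arc_of_not_arc (by rintro rfl; exact hT.not_arc hbz h₁) h₁b
  exact hl.not_two_diagonals ⟨h₁, h₁a, haz⟩ ⟨y₂, b, ⟨h₂b, hbz, h₂⟩, ⟨h₂b, hb₁, h₁₂⟩⟩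
    ⟨y₂, y₀, ⟨h₂₀, h₀₁, h₁₂⟩, ⟨h₂₀, h₀a, ha₂⟩⟩

/-- The out-neighbours of `z` lying in a triangle with `z` span no triangle. -/
theorem not_triangle_of_out (hT : IsTournament arc) (hl : IsLight arc)
    {z y₀ y₁ y₂ : V} (h₀ : arc z y₀) (h₁ : arc z y₁) (h₂ : arc z y₂)
    (e₀ : ∃ a, arc y₀ a ∧ arc a z) (e₁ : ∃ a, arc y₁ a ∧ arc a z)
    (e₂ : ∃ a, arc y₂ a ∧ arc a z) : ¬ Triangle arc y₀ y₁ y₂ := by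
  rintro ⟨h₀₁, h₁₂, h₂₀⟩
  obtain ⟨a, h₀a, haz⟩ := e₀
  obtain ⟨b, h₁b, hbz⟩ := e₁
  obtain ⟨c, h₂c, hcz⟩ := e₂
  have key : ∀ {y d}, arc z y → arc d z → ¬ arc y d → arc d y := fun hy hd h =>
    hT.arc_of_not_arc (by rintro rfl; exact hT.not_arc hd hy) h
  have ha₁ : arc a y₁ := key h₁ haz fun h =>
    hl.not_triangle_of_common_out hT h₀ h₁ h₂ h₀a h h₂c haz hcz ⟨h₀₁, h₁₂, h₂₀⟩
  have hb₂ : arc b y₂ := key h₂ hbz fun h =>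
    hl.not_triangle_of_common_out hT h₁ h₂ h₀ h₁b h h₀a hbz haz ⟨h₁₂, h₂₀, h₀₁⟩
  have hb₀ : arc b y₀ := key h₀ hbz fun h =>
    hl.not_triangle_of_common_out hT h₀ h₁ h₂ h h₁b h₂c hbz hcz ⟨h₀₁, h₁₂, h₂₀⟩
  have hc₁ : arc c y₁ := key h₁ hcz fun h =>
    hl.not_triangle_of_common_out hT h₁ h₂ h₀ h h₂c h₀a hcz haz ⟨h₁₂, h₂₀, h₀₁⟩
  by_cases hab : arc a b
  · exact hl.not_two_diagonals ⟨hbz, h₁, h₁b⟩ ⟨y₀, a, ⟨h₀a, hab, hb₀⟩, ⟨h₀a, haz, h₀⟩⟩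
      ⟨y₂, c, ⟨h₂c, hcz, h₂⟩, ⟨h₂c, hc₁, h₁₂⟩⟩
  have hba : arc b a := hT.arc_of_not_arc (by rintro rfl; exact hT.not_arc h₁b ha₁) hab
  exact hl.not_two_diagonals ⟨h₀a, haz, h₀⟩ ⟨y₁, b, ⟨h₁b, hb₀, h₀₁⟩, ⟨h₁b, hba, ha₁⟩⟩
    ⟨y₁, b, ⟨h₁b, hba, ha₁⟩, ⟨h₁b, hbz, h₁⟩⟩

/-- The in-neighbours of `z` lying in a triangle with `z` span no triangle. -/
theorem not_triangle_of_in (hT : IsTournament arc) (hl : IsLight arc)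
    {z y₀ y₁ y₂ : V} (h₀ : arc y₀ z) (h₁ : arc y₁ z) (h₂ : arc y₂ z)
    (e₀ : ∃ a, arc z a ∧ arc a y₀) (e₁ : ∃ a, arc z a ∧ arc a y₁)
    (e₂ : ∃ a, arc z a ∧ arc a y₂) : ¬ Triangle arc y₀ y₁ y₂ := by
  rintro ⟨h₀₁, h₁₂, h₂₀⟩
  have sw : ∀ {y}, (∃ a, arc z a ∧ arc a y) → ∃ a, _root_.flip arc y a ∧ _root_.flip arc a z :=
    fun ⟨a, ha⟩ => ⟨a, ha.2, ha.1⟩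
  exact hl.flip.not_triangle_of_out hT.flip h₂ h₁ h₀ (sw e₂) (sw e₁) (sw e₀) ⟨h₁₂, h₀₁, h₂₀⟩

end IsLight

open Classical in
/-- Some vertex forms a triangle with each of its in-neighbours. -/
theorem IsTournament.exists_in_saturated [Fintype V] [Nonempty V] {arc : V → V → Prop}
    (hT : IsTournament arc) : ∃ z, ∀ y, arc y z → ∃ a, arc z a ∧ arc a y := by
  obtain ⟨z, hz⟩ := Finite.exists_min fun z => (Finset.univ.filter fun u => arc u z).card
  refine ⟨z, fun y hy => ?_⟩
  by_contra! h
  refine absurd (hz y) (not_le.2 (Finset.card_lt_card ?_))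
  refine Finset.ssubset_iff_of_subset (fun u hu => ?_) |>.2 ⟨y, by simpa using hy, by
    simpa using hT.1 y⟩
  rw [Finset.mem_filter_univ] at hu ⊢
  refine hT.arc_of_not_arc ?_ fun hzu => h u hzu hu
  rintro rfl
  exact hT.not_arc hy hu

/-- Some vertex forms a triangle with each of its out-neighbours. -/
theorem IsTournament.exists_out_saturated [Fintype V] [Nonempty V] {arc : V → V → Prop}
    (hT : IsTournament arc) : ∃ q, ∀ y, arc q y → ∃ a, arc y a ∧ arc a q := by
  obtain ⟨q, hq⟩ := hT.flip.exists_in_saturated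
  exact ⟨q, fun y hy => (hq y hy).imp fun _ h => ⟨h.2, h.1⟩⟩

/-- `ReachIn arc z n v`: there is a directed walk with `n` arcs from `v` to `z`. -/
def ReachIn (arc : V → V → Prop) (z : V) : ℕ → V → Prop
  | 0, v => v = z
  | n + 1, v => ∃ u, arc v u ∧ ReachIn arc z n u

/-- `ℓ` is the distance to the vertex `z` along directed walks. -/
structure IsLevel (arc : V → V → Prop) (z : V) (ℓ : V → ℕ) : Prop where
  eq_root : ∀ v, ℓ v = 0 → v = z
  le_succ : ∀ u v, arc u v → ℓ u ≤ ℓ v + 1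
  exists_arc : ∀ v n, ℓ v = n + 1 → ∃ u, arc v u ∧ ℓ u = n

open Classical in
theorem exists_isLevel {arc : V → V → Prop} {z : V} (h : ∀ v, ∃ n, ReachIn arc z n v) :
    ∃ ℓ, IsLevel arc z ℓ := by
  have le_succ : ∀ u v, arc u v → Nat.find (h u) ≤ Nat.find (h v) + 1 :=
    fun u v huv => Nat.find_min' _ ⟨v, huv, Nat.find_spec (h v)⟩
  refine ⟨fun v => Nat.find (h v), fun v hv => ?_, le_succ, fun v n hv => ?_⟩
  · have := Nat.find_spec (h v)
    rwa [hv] at this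
  · have := Nat.find_spec (h v)
    rw [hv] at this
    obtain ⟨u, hvu, hu⟩ := this
    exact ⟨u, hvu, le_antisymm (Nat.find_min' _ hu) (by have := le_succ v u hvu; omega)⟩

/-- A tournament without triangles on a nonempty finite set has a sink. -/
theorem IsTournament.exists_sink {arc : V → V → Prop} (hT : IsTournament arc) (S : Finset V)
    (hS : S.Nonempty) (h : ∀ a ∈ S, ∀ b ∈ S, ∀ c ∈ S, ¬ Triangle arc a b c) :
    ∃ u ∈ S, ∀ w ∈ S, w ≠ u → arc w u := by
  induction hS using Finset.Nonempty.cons_induction with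
  | singleton a => exact ⟨a, by simp, by simp⟩
  | cons a S ha hS ih =>
    obtain ⟨u, hu, hsink⟩ := ih fun x hx y hy t ht =>
      h x (Finset.mem_cons_of_mem hx) y (Finset.mem_cons_of_mem hy) t (Finset.mem_cons_of_mem ht)
    have hau : a ≠ u := by rintro rfl; exact ha hu
    by_cases huu : arc a u
    · refine ⟨u, Finset.mem_cons_of_mem hu, fun w hw hwu => ?_⟩
      rcases Finset.mem_cons.1 hw with rfl | hw
      exacts [huu, hsink w hw hwu]
    · have hua := hT.arc_of_not_arc hau huu
      refine ⟨a, Finset.mem_cons_self a S, fun w hw hwa => ?_⟩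
      have hwS := (Finset.mem_cons.1 hw).resolve_left hwa
      rcases eq_or_ne w u with rfl | hwu
      · exact hua
      · by_contra hwa'
        exact h a (Finset.mem_cons_self a S) w hw u (Finset.mem_cons_of_mem hu)
          ⟨hT.arc_of_not_arc hwa hwa', hsink w hwS hwu, hua⟩

section Path

variable {arc : V → V → Prop} {z : V} {ℓ : V → ℕ}

/-- `p` lists the vertices of a shortest walk `p k, …, p 0` to the root in which each vertex
`p j` is the sink among the out-neighbours of `p (j + 1)` in level `j`. -/
structure IsSinkPath (arc : V → V → Prop) (ℓ : V → ℕ) (k : ℕ) (p : ℕ → V) : Prop where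
  level : ∀ j ≤ k, ℓ (p j) = j
  step : ∀ j < k, arc (p (j + 1)) (p j)
  sink : ∀ j < k, ∀ w, arc (p (j + 1)) w → ℓ w = j → w ≠ p j → arc w (p j)

theorem IsLevel.exists_sink_step [Finite V] (hT : IsTournament arc) (hl : IsLight arc)
    (hℓ : IsLevel arc z ℓ) {v : V} {n : ℕ} (hv : ℓ v = n + 1) :
    ∃ u, arc v u ∧ ℓ u = n ∧ ∀ w, arc v w → ℓ w = n → w ≠ u → arc w u := by
  classical
  have := Fintype.ofFinite V
  have hS : ∀ w, w ∈ Finset.univ.filter (fun w => arc v w ∧ ℓ w = n) ↔ arc v w ∧ ℓ w = n := by simp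
  obtain ⟨u₀, hu₀⟩ := hℓ.exists_arc v n hv
  obtain ⟨u, hu, hsink⟩ := hT.exists_sink _ ⟨u₀, (hS u₀).2 hu₀⟩ fun a ha b hb c hc => by
    rw [hS] at ha hb hc
    cases n with
    | zero =>
      rintro ⟨hab, -⟩
      rw [hℓ.eq_root a ha.2, hℓ.eq_root b hb.2] at hab
      exact hT.1 z hab
    | succ m =>
      have back : ∀ w, arc v w ∧ ℓ w = m + 1 → ∃ t, arc w t ∧ arc t v := fun w hw => by
        obtain ⟨t, hwt, ht⟩ := hℓ.exists_arc w m hw.2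
        refine ⟨t, hwt, hT.arc_of_not_arc ?_ fun h => ?_⟩
        · rintro rfl
          omega
        · have := hℓ.le_succ v t h
          omega
      exact hl.not_triangle_of_out hT ha.1 hb.1 hc.1 (back a ha) (back b hb) (back c hc)
  rw [hS] at hu
  exact ⟨u, hu.1, hu.2, fun w hvw hw => hsink w ((hS w).2 ⟨hvw, hw⟩)⟩

theorem IsLevel.exists_isSinkPath [Finite V] (hT : IsTournament arc) (hl : IsLight arc)
    (hℓ : IsLevel arc z ℓ) (k : ℕ) (q : V) (hq : ℓ q = k) :
    ∃ p, p k = q ∧ IsSinkPath arc ℓ k p := by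
  induction k generalizing q with
  | zero =>
    exact ⟨fun _ => q, rfl, fun j hj => by simpa [Nat.le_zero.1 hj] using hq,
      fun j hj => absurd hj (Nat.not_lt_zero j), fun j hj => absurd hj (Nat.not_lt_zero j)⟩
  | succ k ih =>
    obtain ⟨u, hqu, hu, hsink⟩ := hℓ.exists_sink_step hT hl hq
    obtain ⟨p, rfl, hp⟩ := ih u hu
    have hne : ∀ j ≤ k, Function.update p (k + 1) q j = p j :=
      fun j hj => Function.update_of_ne (by omega) _ _
    refine ⟨Function.update p (k + 1) q, by simp, fun j hj => ?_, fun j hj => ?_, fun j hj => ?_⟩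
    · rcases Nat.le_succ_iff.1 hj with hj | rfl
      · rw [hne j hj, hp.level j hj]
      · simpa using hq
    · rw [hne j (by omega)]
      rcases Nat.lt_succ_iff_lt_or_eq.1 hj with hj | rfl
      · rw [hne (j + 1) hj]
        exact hp.step j hj
      · simpa using hqu
    · rw [hne j (by omega)]
      rcases Nat.lt_succ_iff_lt_or_eq.1 hj with hj | rfl
      · rw [hne (j + 1) hj]
        exact hp.sink j hj
      · simpa using hsink

/-- `o w` is the least index of an out-neighbour of `w` on the path, or `k + 1` if there is none. -/
structure IsFirstOut (arc : V → V → Prop) (k : ℕ) (p : ℕ → V) (o : V → ℕ) : Prop where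
  le : ∀ w, o w ≤ k + 1
  arc_path : ∀ w, o w ≤ k → arc w (p (o w))
  not_arc : ∀ w, ∀ i < o w, ¬ arc w (p i)

open Classical in
theorem exists_isFirstOut (arc : V → V → Prop) (k : ℕ) (p : ℕ → V) :
    ∃ o, IsFirstOut arc k p o := by
  have h : ∀ w, ∃ i, i = k + 1 ∨ arc w (p i) := fun w => ⟨k + 1, .inl rfl⟩
  refine ⟨fun w => Nat.find (h w), fun w => Nat.find_min' _ (.inl rfl), fun w hw => ?_,
    fun w i hi => fun ha => Nat.find_min (h w) hi (.inr ha)⟩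
  exact (Nat.find_spec (h w)).resolve_left (by omega)

variable {k : ℕ} {p : ℕ → V} {o : V → ℕ}

theorem IsFirstOut.ne_path (hp : IsSinkPath arc ℓ k p) (ho : IsFirstOut arc k p o) {w : V} {j : ℕ}
    (hj : j < o w) (hj₀ : 0 < j) : w ≠ p j := by
  rintro rfl
  have hle := ho.le (p j)
  obtain ⟨i, rfl⟩ : ∃ i, j = i + 1 := ⟨j - 1, by omega⟩
  exact ho.not_arc _ i (by omega) (hp.step i (by omega))

theorem IsFirstOut.le_add_three (hT : IsTournament arc) (hℓ : IsLevel arc z ℓ)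
    (hp : IsSinkPath arc ℓ k p) (ho : IsFirstOut arc k p o) {x y : V} (hxy : arc x y) :
    o x ≤ o y + 3 := by
  by_contra! h
  have hox := ho.le x
  have hy := hℓ.le_succ _ _ (ho.arc_path y (by omega))
  rw [hp.level _ (by omega)] at hy
  have hx := hℓ.le_succ x y hxy
  have hpx : arc (p (o y + 3)) x :=
    hT.arc_of_not_arc (ho.ne_path hp h (by omega)) (ho.not_arc x _ h)
  have hxl := hℓ.le_succ _ _ hpx
  rw [hp.level _ (by omega)] at hxl
  exact ho.not_arc x (o y + 2) (by omega) (hp.sink (o y + 2) (by omega) x hpx (by omega)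
    (ho.ne_path hp (by omega) (by omega)))

theorem IsFirstOut.not_triangle (hT : IsTournament arc) (hl : IsLight arc)
    (hp : IsSinkPath arc ℓ k p) (ho : IsFirstOut arc k p o)
    (hz : ∀ y, arc y (p 0) → ∃ a, arc (p 0) a ∧ arc a y)
    (hq : ∀ y, arc (p k) y → ∃ a, arc y a ∧ arc a (p k)) {m : ℕ} {a b c : V}
    (ha : o a = m) (hb : o b = m) (hc : o c = m) : ¬ Triangle arc a b c := by
  rintro ⟨hab, hbc, hca⟩
  have out : ∀ w, o w = m → m ≤ k → arc w (p m) := by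
    rintro w rfl hw
    exact ho.arc_path w hw
  rcases m with _ | m
  · have ha' := out a ha k.zero_le
    have hb' := out b hb k.zero_le
    have hc' := out c hc k.zero_le
    exact hl.not_triangle_of_in hT ha' hb' hc' (hz a ha') (hz b hb') (hz c hc') ⟨hab, hbc, hca⟩
  have from_path : ∀ v w, arc v w → o v = m + 1 → o w = m + 1 → arc (p m) w :=
    fun v w hvw hv hw => by
      refine hT.arc_of_not_arc ?_ (ho.not_arc w m (by omega))
      rintro rfl
      exact ho.not_arc v m (by omega) hvw
  have ha' := from_path c a hca hc ha
  have hb' := from_path a b hab ha hb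
  have hc' := from_path b c hbc hb hc
  rcases Nat.lt_or_ge m k with hm | hm
  · exact hl.not_triangle_of_arc (hp.step m hm) ha' hb' hc' (out a ha hm) (out b hb hm)
      (out c hc hm) ⟨hab, hbc, hca⟩
  · have hle := ho.le a
    obtain rfl : m = k := by omega
    exact hl.not_triangle_of_out hT ha' hb' hc' (hq a ha') (hq b hb') (hq c hc') ⟨hab, hbc, hca⟩

end Path

/-- `c` is a colouring without monochromatic triangles. -/
def IsTriangleColoring {α : Type*} (arc : V → V → Prop) (c : V → α) : Prop :=
  ∀ x y t, c x = c y → c y = c t → ¬ Triangle arc x y t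

theorem IsLight.exists_coloring_of_reachIn [Finite V] {arc : V → V → Prop} (hl : IsLight arc)
    (hT : IsTournament arc) {z : V} (hz : ∀ y, arc y z → ∃ a, arc z a ∧ arc a y)
    (hreach : ∀ v, ∃ n, ReachIn arc z n v) : ∃ c : V → Fin 4, IsTriangleColoring arc c := by
  have := Fintype.ofFinite V
  have : Nonempty V := ⟨z⟩
  obtain ⟨q, hq⟩ := hT.exists_out_saturated
  obtain ⟨ℓ, hℓ⟩ := exists_isLevel hreach
  obtain ⟨k, hk⟩ : ∃ k, ℓ q = k := ⟨_, rfl⟩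
  obtain ⟨p, rfl, hp⟩ := hℓ.exists_isSinkPath hT hl k q hk
  obtain rfl := hℓ.eq_root _ (hp.level 0 (Nat.zero_le _))
  obtain ⟨o, ho⟩ := exists_isFirstOut arc k p
  refine ⟨fun w => Fin.ofNat 4 (o w), fun x y t hxy hyt htri => ?_⟩
  simp only [Fin.ofNat, Fin.mk.injEq] at hxy hyt
  have h₁ := ho.le_add_three hT hℓ hp htri.1
  have h₂ := ho.le_add_three hT hℓ hp htri.2.1
  have h₃ := ho.le_add_three hT hℓ hp htri.2.2
  exact ho.not_triangle hT hl hp hz hq (m := o x) rfl (by omega) (by omega) htri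

theorem IsLight.exists_coloring {V : Type*} [Finite V] {arc : V → V → Prop} (hl : IsLight arc)
    (hT : IsTournament arc) : ∃ c : V → Fin 4, IsTriangleColoring arc c := by
  classical
  induction h : Nat.card V using Nat.strong_induction_on generalizing V with
  | _ n ih =>
  subst h
  have := Fintype.ofFinite V
  cases isEmpty_or_nonempty V with
  | inl _ => exact ⟨fun _ => 0, fun x => isEmptyElim x⟩
  | inr _ =>
  obtain ⟨z, hz⟩ := hT.exists_in_saturated
  by_cases hreach : ∀ v, ∃ n, ReachIn arc z n v
  · exact hl.exists_coloring_of_reachIn hT hz hreach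
  push Not at hreach
  obtain ⟨r, hr⟩ := hreach
  let R : V → Prop := fun v => ∃ n, ReachIn arc z n v
  have hRz : R z := ⟨0, rfl⟩
  have hRr : ¬ R r := fun ⟨n, hn⟩ => hr n hn
  have back : ∀ {u v}, arc u v → R v → R u := fun huv ⟨n, hn⟩ => ⟨n + 1, _, huv, hn⟩
  obtain ⟨c, hc⟩ := ih (Nat.card {v // R v}) (Finite.card_subtype_lt hRr)
    (hl.comap Subtype.val) (hT.comap Subtype.val_injective) rfl
  obtain ⟨d, hd⟩ := ih (Nat.card {v // ¬ R v}) (Finite.card_subtype_lt (not_not.2 hRz))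
    (hl.comap Subtype.val) (hT.comap Subtype.val_injective) rfl
  refine ⟨fun v => if hv : R v then c ⟨v, hv⟩ else d ⟨v, hv⟩, fun x y t hxy hyt htri => ?_⟩
  by_cases hx : R x
  · have ht := back htri.2.2 hx
    have hy := back htri.2.1 ht
    simp only [hx, hy, ht, dite_true] at hxy hyt
    exact hc _ _ _ hxy hyt htri
  · have hy : ¬ R y := fun h => hx (back htri.1 h)
    have ht : ¬ R t := fun h => hy (back htri.2.1 h)
    simp only [hx, hy, ht, dite_false] at hxy hyt
    exact hd _ _ _ hxy hyt htri

theorem SA0Val_le [Fintype V] {arc : V → V → Prop} {w : V → ℚ} (hw : ∀ v, 0 < w v) {x : V → ℝ}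
    (hx : BasicFeasible arc x) : SA0Val arc w ≤ ∑ v, (w v : ℝ) * x v := by
  refine csInf_le ⟨0, ?_⟩ ⟨x, hx, rfl⟩
  rintro _ ⟨y, hy, rfl⟩
  exact Finset.sum_nonneg fun v _ => mul_nonneg (by exact_mod_cast (hw v).le) (hy.1 v).1

/-- An optimal solution with all values in `(0, 1/2)` costs at least a third of the weight. -/
theorem sum_weight_le [Fintype V] {arc : V → V → Prop} {w : V → ℚ} (hw : ∀ v, 0 < w v)
    {x : V → ℝ} (hx : BasicFeasible arc x) (hopt : ∑ v, (w v : ℝ) * x v = SA0Val arc w)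
    (hpos : ∀ v, 0 < x v) (hhalf : ∀ v, x v < 1 / 2) :
    ∑ v, (w v : ℝ) ≤ 3 * SA0Val arc w := by
  cases isEmpty_or_nonempty V with
  | inl _ => simp [← hopt]
  | inr _ =>
  obtain ⟨u, hu⟩ := Finite.exists_min x
  have hfeas : BasicFeasible arc fun v => x v + x u * (x v - 1 / 3) := by
    refine ⟨fun v => ⟨?_, ?_⟩, fun a b c h => ?_⟩ <;> dsimp only
    · nlinarith [hu v, mul_pos (hpos u) (hpos v), hpos u]
    · nlinarith [hhalf v, hhalf u, hpos u]
    · nlinarith [hx.2 a b c h, hpos u]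
  have hle := SA0Val_le hw hfeas
  have hsum : ∑ v, (w v : ℝ) * (x v + x u * (x v - 1 / 3)) =
      SA0Val arc w + x u * (SA0Val arc w - (∑ v, (w v : ℝ)) / 3) := by
    rw [← hopt, Finset.sum_div, ← Finset.sum_sub_distrib, Finset.mul_sum, ← Finset.sum_add_distrib]
    exact Finset.sum_congr rfl fun v _ => by ring
  rw [hsum] at hle
  have := nonneg_of_mul_nonneg_right (le_of_add_le_add_left ((add_zero _).trans_le hle)) (hpos u)
  linarith

/-- Let `T` be a light tournament with strictly positive weights in which every
vertex lies in a triangle, and suppose some optimal solution `x` of the basic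
relaxation has `x_v < 1/2` everywhere. Then `T` has a feedback vertex set `F'`
with `w(F') ≤ (9/4)·SA₀(T,w)`. -/
theorem stmt11 [Fintype V] (arc : V → V → Prop) (hT : IsTournament arc)
    (hlight : IsLight arc) (w : V → ℚ) (hw : ∀ v, 0 < w v)
    (htri : ∀ v : V, ∃ a b : V, Triangle arc v a b)
    (x : V → ℝ) (hx : BasicFeasible arc x)
    (hopt : ∑ v, (w v : ℝ) * x v = SA0Val arc w)
    (hhalf : ∀ v, x v < 1 / 2) :
    ∃ F : Finset V, IsFVS arc (↑F : Set V) ∧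
      (∑ v ∈ F, (w v : ℝ)) ≤ 9 / 4 * SA0Val arc w := by
  classical
  have hpos : ∀ v, 0 < x v := fun v => by
    obtain ⟨a, b, h⟩ := htri v
    linarith [hx.2 v a b h, hhalf a, hhalf b]
  have hle := sum_weight_le hw hx hopt hpos hhalf
  obtain ⟨c, hc⟩ := hlight.exists_coloring hT
  have hfib : ∑ i : Fin 4, ∑ v with c v = i, (w v : ℝ) = ∑ v, (w v : ℝ) :=
    Finset.sum_fiberwise _ _ _
  obtain ⟨i, -, hi⟩ : ∃ i ∈ Finset.univ, (∑ v, (w v : ℝ)) / 4 ≤ ∑ v with c v = i, (w v : ℝ) :=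
    Finset.exists_le_of_sum_le (s := Finset.univ) Finset.univ_nonempty (by
      rw [hfib, Finset.sum_const, Finset.card_univ, Fintype.card_fin, nsmul_eq_mul]
      push_cast
      linarith)
  refine ⟨Finset.univ.filter fun v => c v ≠ i, fun a b t ha hb ht => ?_, ?_⟩
  · simp only [Finset.coe_filter_univ, Set.mem_ofPred_eq, not_not] at ha hb ht
    exact hc a b t (ha.trans hb.symm) (hb.trans ht.symm)
  · have := Finset.sum_filter_add_sum_filter_not Finset.univ (fun v => c v = i) fun v => (w v : ℝ)
    linarith
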